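/- Let C > 0 and δ ∈ (0,1] be reals with ‖x‖₀ ≤ C·n^{1−δ} for every x ∈ X, let ε > 0, and let l be an integer with 1 ≤ l ≤ n−1. If n ≥ l^{1/δ}·(C·M_∞/ε + 1)^{1/δ}, then opt(n) ≤ opt(n−l) ≤ opt(n) + ε. -/

import Mathlib

open scoped BigOperators

/-- Dot product of two vectors in `ℝ^ν`. -/
noncomputable def dot {ν : ℕ} (c x : Fin ν → ℝ) : ℝ := ∑ j, c j * x j

/-- `convComb X k` is the set `X(k)` of all convex combinations of at most `k` points of `X`. -/
def convComb {ν : ℕ} (X : Set (Fin ν → ℝ)) (k : ℕ) : Set (Fin ν → ℝ) :=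
  { x | ∃ (xs : Fin k → (Fin ν → ℝ)) (lam : Fin k → ℝ),
      (∀ i, xs i ∈ X) ∧ (∀ i, 0 ≤ lam i) ∧ (∑ i, lam i) = 1 ∧
      x = ∑ i, lam i • xs i }

/-- The worst-case objective `max_{c ∈ U} cᵀx`. -/
noncomputable def objSup {ν : ℕ} (U : Set (Fin ν → ℝ)) (x : Fin ν → ℝ) : ℝ :=
  sSup ((fun c => dot c x) '' U)

/-- `opt(k) = min_{x ∈ X(k)} max_{c ∈ U} cᵀx`. -/
noncomputable def optVal {ν : ℕ} (X U : Set (Fin ν → ℝ)) (k : ℕ) : ℝ :=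
  sInf (objSup U '' convComb X k)

/-- `‖x‖₀`, the number of nonzero entries of `x`, as a real number. -/
noncomputable def zeroNorm {ν : ℕ} (x : Fin ν → ℝ) : ℝ :=
  ((Finset.univ.filter (fun j => x j ≠ 0)).card : ℝ)

/-- The min-max-min robust value over `k`-tuples of feasible solutions:
`min_{x¹,…,x^k ∈ X} max_{c ∈ U} min_{i} cᵀxⁱ`. -/
noncomputable def minmaxVal {ν : ℕ} (X U : Set (Fin ν → ℝ)) (k : ℕ) : ℝ :=
  sInf { v : ℝ | ∃ xs : Fin k → (Fin ν → ℝ), (∀ i, xs i ∈ X) ∧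
    v = sSup ((fun c => ⨅ i, dot c (xs i)) '' U) }

/-- `app(k)`, the objective value of the `k` solutions `x¹,…,x^k` with largest weights
returned by Algorithm 1: `max_{c ∈ U} min_{i=1,…,k} cᵀxⁱ`. -/
noncomputable def appVal {ν : ℕ} (U : Set (Fin ν → ℝ)) (xs : Fin ν → (Fin ν → ℝ)) (k : ℕ) : ℝ :=
  sSup ((fun c => ⨅ i : {i : Fin ν // (i : ℕ) < k}, dot c (xs i.1)) '' U)

theorem dot_smul {ν : ℕ} (a : ℝ) (c x : Fin ν → ℝ) : dot c (a • x) = a * dot c x :=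
  dotProduct_smul a c x

theorem dot_sum {ν : ℕ} {ι : Type*} (s : Finset ι) (c : Fin ν → ℝ) (f : ι → Fin ν → ℝ) :
    dot c (∑ i ∈ s, f i) = ∑ i ∈ s, dot c (f i) :=
  dotProduct_sum c s f

theorem dot_nonneg {ν : ℕ} {c x : Fin ν → ℝ} (hc : ∀ j, 0 ≤ c j) (hx : ∀ j, 0 ≤ x j) :
    0 ≤ dot c x :=
  Finset.sum_nonneg fun j _ => mul_nonneg (hc j) (hx j)

theorem nonneg_of_binary {ν : ℕ} {x : Fin ν → ℝ} (hx : ∀ j, x j = 0 ∨ x j = 1) (j : Fin ν) :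
    0 ≤ x j := by
  rcases hx j with h | h <;> simp [h]

/-- Against a binary vector, entries bounded by `M` give a dot product of at most `M * ‖x‖₀`. -/
theorem dot_le_mul_zeroNorm {ν : ℕ} {c x : Fin ν → ℝ} {M : ℝ} (hc : ∀ j, c j ≤ M)
    (hx : ∀ j, x j = 0 ∨ x j = 1) : dot c x ≤ M * zeroNorm x := by
  have h : M * zeroNorm x = ∑ j, if x j ≠ 0 then M else 0 := by
    rw [← Finset.sum_filter, Finset.sum_const, nsmul_eq_mul, mul_comm, zeroNorm]
  rw [h, dot]
  refine Finset.sum_le_sum fun j _ => ?_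
  rcases hx j with h | h <;> simp [h, hc j]

theorem bddAbove_dot_image {ν : ℕ} {U : Set (Fin ν → ℝ)} (hU : IsCompact U) (x : Fin ν → ℝ) :
    BddAbove ((fun c => dot c x) '' U) := by
  refine hU.bddAbove_image (Continuous.continuousOn ?_)
  unfold dot
  fun_prop

/-- A convex combination indexed by a type with at most `k` elements lies in `X(k)`. -/
theorem sum_smul_mem_convComb {ν k : ℕ} {X : Set (Fin ν → ℝ)} {ι : Type*} [Fintype ι]
    (hk : Fintype.card ι ≤ k) {z : ι → Fin ν → ℝ} {w : ι → ℝ} (hX : X.Nonempty)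
    (hz : ∀ i, z i ∈ X) (hw : ∀ i, 0 ≤ w i) (hsum : ∑ i, w i = 1) :
    ∑ i, w i • z i ∈ convComb X k := by
  obtain ⟨x₀, hx₀⟩ := hX
  obtain ⟨f⟩ : Nonempty (ι ↪ Fin k) := Function.Embedding.nonempty_of_card_le (by simpa using hk)
  refine ⟨Function.extend f z fun _ => x₀, Function.extend f w 0, fun i => ?_, fun i => ?_, ?_, ?_⟩
  · by_cases h : ∃ a, f a = i
    · obtain ⟨a, rfl⟩ := h
      rw [f.injective.extend_apply]
      exact hz a
    · rwa [Function.extend_apply' _ _ _ h]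
  · by_cases h : ∃ a, f a = i
    · obtain ⟨a, rfl⟩ := h
      rw [f.injective.extend_apply]
      exact hw a
    · rw [Function.extend_apply' _ _ _ h, Pi.zero_apply]
  · rw [← hsum]
    refine (Fintype.sum_of_injective f f.injective _ _ (fun i hi => ?_) fun i => ?_).symm
    · rw [Function.extend_apply' _ _ _ hi, Pi.zero_apply]
    · rw [f.injective.extend_apply]
  · refine Fintype.sum_of_injective f f.injective _ _ (fun i hi => ?_) fun i => ?_
    · rw [Function.extend_apply' w _ _ hi, Pi.zero_apply, zero_smul]
    · rw [f.injective.extend_apply, f.injective.extend_apply]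

theorem convComb_mono {ν k m : ℕ} {X : Set (Fin ν → ℝ)} (hX : X.Nonempty) (hkm : k ≤ m) :
    convComb X k ⊆ convComb X m := by
  rintro _ ⟨xs, lam, hxs, hlam, hsum, rfl⟩
  exact sum_smul_mem_convComb (by simpa using hkm) hX hxs hlam hsum

theorem convComb_nonempty {ν k : ℕ} {X : Set (Fin ν → ℝ)} (hX : X.Nonempty) (hk : 1 ≤ k) :
    (convComb X k).Nonempty := by
  obtain ⟨x₀, hx₀⟩ := id hX
  exact ⟨_, sum_smul_mem_convComb (ι := Unit) (z := fun _ => x₀) (w := fun _ => 1)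
    (by simpa using hk) hX (fun _ => hx₀) (by simp) (by simp)⟩

theorem nonneg_of_mem_convComb {ν k : ℕ} {X : Set (Fin ν → ℝ)} (hX : ∀ x ∈ X, ∀ j, 0 ≤ x j)
    {x : Fin ν → ℝ} (hx : x ∈ convComb X k) (j : Fin ν) : 0 ≤ x j := by
  obtain ⟨xs, lam, hxs, hlam, -, rfl⟩ := hx
  rw [Finset.sum_apply]
  exact Finset.sum_nonneg fun i _ => mul_nonneg (hlam i) (hX _ (hxs i) j)

/-- The average of some `l` of the numbers `w i` does not exceed the average of all of them. -/
theorem exists_card_eq_mul_sum_le {ι : Type*} [Fintype ι] [DecidableEq ι] (w : ι → ℝ) (l : ℕ)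
    (hl : l ≤ Fintype.card ι) :
    ∃ T : Finset ι, T.card = l ∧ (Fintype.card ι : ℝ) * ∑ i ∈ T, w i ≤ l * ∑ i, w i := by
  induction l with
  | zero => exact ⟨∅, by simp⟩
  | succ l ih =>
    obtain ⟨T, hT, hle⟩ := ih (by omega)
    have hcard : (Tᶜ.card : ℝ) = Fintype.card ι - l := by
      rw [Finset.card_compl, hT, Nat.cast_sub (by omega)]
    have hne : Tᶜ.Nonempty := by
      rw [← Finset.card_pos, Finset.card_compl]
      omega
    obtain ⟨j, hj, hmin⟩ := Finset.exists_min_image Tᶜ w hne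
    have hjT : j ∉ T := Finset.mem_compl.mp hj
    refine ⟨insert j T, by rw [Finset.card_insert_of_notMem hjT, hT], ?_⟩
    have hwj := Finset.card_nsmul_le_sum Tᶜ w (w j) hmin
    rw [nsmul_eq_mul, hcard] at hwj
    have hsplit := Finset.sum_add_sum_compl T w
    rw [Finset.sum_insert hjT]
    push_cast
    have hlt : (1 : ℝ) ≤ Fintype.card ι - l := by
      have : ((l + 1 : ℕ) : ℝ) ≤ Fintype.card ι := by exact_mod_cast hl
      push_cast at this
      linarith
    have hN : (0 : ℝ) ≤ Fintype.card ι := Nat.cast_nonneg _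
    generalize (Fintype.card ι : ℝ) = N at *
    generalize (l : ℝ) = L at *
    have hL : 0 < N - L := by linarith
    refine le_of_mul_le_mul_left ?_ hL
    nlinarith [mul_le_mul_of_nonneg_left hwj hN,
      mul_le_mul_of_nonneg_left hle (by linarith : 0 ≤ N - L - 1)]

/-- Discarding `l` of the points of a convex combination of `n` binary vectors changes the
dot product by at most an `l / n` fraction of a uniform bound `B` on the dot products. -/
theorem exists_mem_convComb_dot_le {ν n l : ℕ} {X U : Set (Fin ν → ℝ)} (hX : X.Nonempty)
    (hln : l < n) {B : ℝ} (hB : ∀ c ∈ U, ∀ x ∈ X, dot c x ≤ B)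
    (hnonneg : ∀ c ∈ U, ∀ x ∈ X, 0 ≤ dot c x)
    {x : Fin ν → ℝ} (hx : x ∈ convComb X n) :
    ∃ y ∈ convComb X (n - l), ∀ c ∈ U, dot c y ≤ dot c x + l / n * B := by
  obtain ⟨xs, lam, hxs, hlam, hsum, rfl⟩ := hx
  obtain ⟨T, hT, hle⟩ := exists_card_eq_mul_sum_le lam l (by simpa using hln.le)
  rw [hsum, Fintype.card_fin, mul_one] at hle
  have hn : (0 : ℝ) < n := by exact_mod_cast (by omega : 0 < n)
  have hs : ∑ i ∈ T, lam i ≤ l / n := by rwa [le_div_iff₀' hn]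
  have hcard : Fintype.card {i // i ∈ Tᶜ} = n - l := by
    rw [Fintype.card_coe, Finset.card_compl, hT, Fintype.card_fin]
  obtain ⟨i₀⟩ : Nonempty {i // i ∈ Tᶜ} := by
    rw [← Fintype.card_pos_iff]
    omega
  have hs0 : 0 ≤ ∑ i ∈ T, lam i := Finset.sum_nonneg fun i _ => hlam i
  have hsplit (g : Fin n → ℝ) : ∑ i ∈ T, g i + ∑ i : {i // i ∈ Tᶜ}, g i = ∑ i, g i := by
    rw [Finset.sum_coe_sort Tᶜ g, Finset.sum_add_sum_compl]
  refine ⟨_, sum_smul_mem_convComb (w := fun i => lam i + if i = i₀ then ∑ i ∈ T, lam i else 0)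
    hcard.le hX (fun i : {i // i ∈ Tᶜ} => hxs i) (fun i => ?_) ?_, fun c hc => ?_⟩
  · split_ifs
    · exact add_nonneg (hlam i) hs0
    · simpa using hlam i
  · rw [Finset.sum_add_distrib, Finset.sum_ite_eq' Finset.univ i₀, if_pos (Finset.mem_univ _),
      add_comm, hsplit, hsum]
  · have hmove : (∑ i ∈ T, lam i) * dot c (xs i₀) ≤ l / n * B :=
      mul_le_mul hs (hB c hc _ (hxs i₀)) (hnonneg c hc _ (hxs i₀)) (by positivity)
    have hdrop : 0 ≤ ∑ i ∈ T, lam i * dot c (xs i) :=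
      Finset.sum_nonneg fun i _ => mul_nonneg (hlam i) (hnonneg c hc _ (hxs i))
    have := hsplit fun i => lam i * dot c (xs i)
    simp only [dot_sum, dot_smul, add_mul, ite_mul, zero_mul, Finset.sum_add_distrib,
      Finset.sum_ite_eq', Finset.mem_univ, if_true]
    linarith

theorem div_mul_rpow_le_of_rpow_le {n l C M δ ε : ℝ} (hn : 0 < n) (hl : 0 ≤ l) (hC : 0 ≤ C)
    (hM : 0 ≤ M) (hδ : 0 < δ) (hε : 0 < ε)
    (h : l ^ (1 / δ) * (C * M / ε + 1) ^ (1 / δ) ≤ n) :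
    l / n * (M * (C * n ^ (1 - δ))) ≤ ε := by
  have ha : 0 ≤ C * M / ε + 1 := by positivity
  have hQ : l * (C * M / ε + 1) ≤ n ^ δ := by
    rw [← Real.mul_rpow hl ha] at h
    have := Real.rpow_le_rpow (by positivity) h hδ.le
    rwa [← Real.rpow_mul (by positivity), one_div_mul_cancel hδ.ne', Real.rpow_one] at this
  have hQ0 : 0 < n ^ δ := Real.rpow_pos_of_pos hn δ
  rw [Real.rpow_sub hn, Real.rpow_one,
    show l / n * (M * (C * (n / n ^ δ))) = l * (C * M) / n ^ δ by field_simp, div_le_iff₀ hQ0]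
  calc l * (C * M) ≤ l * (C * M) + ε * l := by nlinarith
    _ = ε * (l * (C * M / ε + 1)) := by field_simp
    _ ≤ ε * n ^ δ := by gcongr

/-- If `‖x‖₀ ≤ C·n^{1−δ}` for all `x ∈ X` (with `C > 0`, `δ ∈ (0,1]`),
`ε > 0`, `1 ≤ l ≤ n−1`, and `n ≥ l^{1/δ}·(C·M_∞/ε + 1)^{1/δ}`, then
`opt(n) ≤ opt(n−l) ≤ opt(n) + ε`. -/
theorem stmt8 (n : ℕ) (hn : 0 < n)
    (X : Set (Fin n → ℝ)) (hXfin : X.Finite) (hXne : X.Nonempty)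
    (hXbin : ∀ x ∈ X, ∀ j, x j = 0 ∨ x j = 1)
    (U : Set (Fin n → ℝ)) (hUne : U.Nonempty) (hUcomp : IsCompact U) (hUconv : Convex ℝ U)
    (M_inf : ℝ) (hc : ∀ c ∈ U, ∀ j, 0 ≤ c j ∧ c j ≤ M_inf)
    (C δ : ℝ) (hC : 0 < C) (hδ0 : 0 < δ) (hδ1 : δ ≤ 1)
    (hbound : ∀ x ∈ X, zeroNorm x ≤ C * (n : ℝ) ^ (1 - δ))
    (ε : ℝ) (hε : 0 < ε) (l : ℕ) (hl1 : 1 ≤ l) (hln : l ≤ n - 1)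
    (hnlarge : (l : ℝ) ^ (1 / δ) * (C * M_inf / ε + 1) ^ (1 / δ) ≤ (n : ℝ)) :
    optVal X U n ≤ optVal X U (n - l) ∧ optVal X U (n - l) ≤ optVal X U n + ε := by
  have hXnn : ∀ x ∈ X, ∀ j, 0 ≤ x j := fun x hx => nonneg_of_binary (hXbin x hx)
  have hM : 0 ≤ M_inf := by
    obtain ⟨c, hcU⟩ := hUne
    exact (hc c hcU ⟨0, hn⟩).1.trans (hc c hcU ⟨0, hn⟩).2
  have hbdd (k : ℕ) : BddBelow (objSup U '' convComb X k) := by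
    refine ⟨0, ?_⟩
    rintro _ ⟨x, hx, rfl⟩
    refine Real.sSup_nonneg ?_
    rintro _ ⟨c, hcU, rfl⟩
    exact dot_nonneg (fun j => (hc c hcU j).1) (nonneg_of_mem_convComb hXnn hx)
  refine ⟨csInf_le_csInf (hbdd n) ((convComb_nonempty hXne (by omega)).image _)
    (Set.image_mono (convComb_mono hXne (Nat.sub_le n l))), ?_⟩
  rw [← sub_le_iff_le_add]
  refine le_csInf ((convComb_nonempty hXne hn).image _) ?_
  rintro _ ⟨x, hx, rfl⟩
  rw [sub_le_iff_le_add]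
  obtain ⟨y, hy, hyx⟩ := exists_mem_convComb_dot_le (U := U) hXne (by omega : l < n)
    (B := M_inf * (C * (n : ℝ) ^ (1 - δ)))
    (fun c hcU z hz => (dot_le_mul_zeroNorm (fun j => (hc c hcU j).2) (hXbin z hz)).trans
      (mul_le_mul_of_nonneg_left (hbound z hz) hM))
    (fun c hcU z hz => dot_nonneg (fun j => (hc c hcU j).1) (hXnn z hz)) hx
  refine (csInf_le (hbdd _) (Set.mem_image_of_mem _ hy)).trans (csSup_le (hUne.image _) ?_)
  rintro _ ⟨c, hcU, rfl⟩
  exact (hyx c hcU).trans (add_le_add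
    (le_csSup (bddAbove_dot_image hUcomp x) (Set.mem_image_of_mem _ hcU))
    (div_mul_rpow_le_of_rpow_le (by exact_mod_cast hn) l.cast_nonneg hC.le hM hδ0 hε hnlarge))
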